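/- For all $m>0$, $T>0$ and $t\in(0,T)$, $(T-t)e^{-m(T-t)}-\Xi(mT)\,t\,(1-e^{-m(T-t)})\ge 0$, where $\Xi(x)=\inf_{0<\beta<1}\frac{\beta e^{-\beta x}}{(1-\beta)(1-e^{-\beta x})}$. -/

import Mathlib

noncomputable def Xi (x : ℝ) : ℝ :=
  sInf ((fun β : ℝ => β * Real.exp (-β * x) /
    ((1 - β) * (1 - Real.exp (-β * x)))) '' Set.Ioo 0 1)

theorem stmt6 (m T t : ℝ) (hm : 0 < m) (hT : 0 < T) (ht : t ∈ Set.Ioo (0 : ℝ) T) :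
    0 ≤ (T - t) * Real.exp (-m * (T - t)) -
      Xi (m * T) * t * (1 - Real.exp (-m * (T - t))) := by
  obtain ⟨h0, h1⟩ := ht
  have hs : 0 < T - t := by linarith
  have hE : Real.exp (-m * (T - t)) < 1 := by
    rw [Real.exp_lt_one_iff]
    nlinarith [mul_pos hm hs]
  have hb : Xi (m * T) ≤ (T - t) * Real.exp (-m * (T - t)) /
      (t * (1 - Real.exp (-m * (T - t)))) := by
    unfold Xi
    apply csInf_le
    · refine ⟨0, ?_⟩
      rintro _ ⟨β, ⟨hβ0, hβ1⟩, rfl⟩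
      have h2 : Real.exp (-β * (m * T)) ≤ 1 := by
        rw [Real.exp_le_one_iff]
        nlinarith [mul_pos hβ0 (mul_pos hm hT)]
      exact div_nonneg (mul_nonneg hβ0.le (Real.exp_pos _).le)
        (mul_nonneg (by linarith) (by linarith))
    · refine ⟨(T - t) / T, ⟨div_pos hs hT, ?_⟩, ?_⟩
      · rw [div_lt_one hT]
        linarith
      · have e1 : -((T - t) / T) * (m * T) = -m * (T - t) := by
          field_simp
        have e2 : 1 - (T - t) / T = t / T := by
          field_simp
          ring
        have hne : 1 - Real.exp (-m * (T - t)) ≠ 0 := (sub_pos.mpr hE).ne'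
        simp only [e1, e2]
        field_simp
  have hp : 0 < t * (1 - Real.exp (-m * (T - t))) := mul_pos h0 (by linarith)
  rw [le_div_iff₀ hp] at hb
  linarith
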